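/- arXiv:2507.05862 — 2 statements merged into one kernel-verified Lean document; each statement's English description precedes it below -/
import Mathlib

section
/- Let p be a prime with p ≡ 1 (mod 3) such that 2 and 3 are cubic residues modulo p, and write p = x² + 243·y² with integers x, y satisfying x ≡ 3y − 1 (mod 6) and y > 0. Let q be a prime with q > 3, q ≡ 1 (mod 3), and q ≠ p, and let s be an element of the finite field F_q with s² = −3 (such an s exists since q ≡ 1 mod 3). Then q is a cubic residue modulo p (i.e., there exists an integer a with a³ ≡ q (mod p)) if and only if ( p·(x − 9·y·s) )^{(q−1)/3} = 1 in F_q, where p, x, y are interpreted in F_q via reduction modulo q. -/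
/-- The ring of Eisenstein integers. -/
abbrev EisRing := QuadraticAlgebra ℤ (-1) (-1)

lemma eis_norm (z : EisRing) : z.norm = z.re ^ 2 - z.re * z.im + z.im ^ 2 := by
  rw [QuadraticAlgebra.norm_def]; ring

lemma eis_norm_eq_zero {z : EisRing} (h : z.norm = 0) : z = 0 := by
  rw [eis_norm] at h
  have h1 : z.im = 0 := by nlinarith [sq_nonneg (2 * z.re - z.im), sq_nonneg z.im]
  have h2 : z.re = 0 := by rw [h1] at h; nlinarith
  ext <;> simp [h1, h2]

instance eis_noZeroDivisors : NoZeroDivisors EisRing where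
  eq_zero_or_eq_zero_of_mul_eq_zero {a b} h := by
    have := congrArg QuadraticAlgebra.norm h
    rw [map_mul, QuadraticAlgebra.norm_zero] at this
    rcases mul_eq_zero.mp this with h | h
    · exact Or.inl (eis_norm_eq_zero h)
    · exact Or.inr (eis_norm_eq_zero h)

instance eis_isDomain : IsDomain EisRing := NoZeroDivisors.to_isDomain _

/-- The primitive cube root of unity. -/
def eisW : EisRing := ⟨0, 1⟩

@[simp] lemma eis_re_one : (1 : EisRing).re = 1 := rfl

@[simp] lemma eis_im_one : (1 : EisRing).im = 0 := rfl

lemma eisW_sq : eisW ^ 2 = -1 - eisW := by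
  rw [pow_two]; ext <;> simp [eisW]

lemma eisW_cube : eisW ^ 3 = 1 := by
  have h := eisW_sq
  linear_combination (eisW - 1) * h

lemma eisW_prim : IsPrimitiveRoot eisW 3 := by
  refine IsPrimitiveRoot.of_map_of_injective (f := RingHom.id EisRing) ?_ Function.injective_id
  have : orderOf eisW = 3 := orderOf_eq_prime eisW_cube (by
    intro h
    have := congrArg QuadraticAlgebra.im h
    simp [eisW] at this)
  exact this ▸ IsPrimitiveRoot.orderOf eisW

lemma eis_star_eisW : star eisW = eisW ^ 2 := by
  rw [eisW_sq]; ext <;> simp [eisW]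

lemma eis_star_char {p : ℕ} [Fact p.Prime] {χ : MulChar (ZMod p) EisRing} (h : χ ^ 3 = 1) :
    χ⁻¹ = χ.ringHomComp (starRingEnd EisRing) := by
  refine MulChar.ext fun a => ?_
  obtain ⟨k, _, hk⟩ := χ.exists_apply_eq_pow h eisW_prim a.ne_zero
  have h1 : χ⁻¹ = χ ^ 2 := by
    rw [inv_eq_iff_mul_eq_one, ← pow_succ', h]
  rw [h1, MulChar.pow_apply_coe, MulChar.ringHomComp_apply, hk, starRingEnd_apply, star_pow,
    eis_star_eisW]
  ring

lemma eis_jacobi_norm {p : ℕ} [Fact p.Prime] {χ : MulChar (ZMod p) EisRing}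
    (h : orderOf χ = 3) : (jacobiSum χ χ).norm = p := by
  have h3 : χ ^ 3 = 1 := h ▸ pow_orderOf_eq_one χ
  let i := algebraMap EisRing (FractionRing EisRing)
  have hi : Function.Injective i := IsFractionRing.injective _ _
  have : CharZero EisRing := ⟨fun a b hab => by
    have := congrArg QuadraticAlgebra.re hab
    simpa using this⟩
  have : CharZero (FractionRing EisRing) := ⟨fun a b hab => by
    have : i a = i b := by simpa using hab
    exact_mod_cast hi this⟩
  have hne : χ ≠ 1 := by rintro rfl; simp at h
  have hne2 : χ * χ ≠ 1 := by
    intro hh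
    have : orderOf χ ∣ 2 := orderOf_dvd_of_pow_eq_one (by rw [pow_two, hh])
    rw [h] at this; omega
  have key := jacobiSum_mul_jacobiSum_inv (F := ZMod p) (F' := FractionRing EisRing)
    (χ := χ.ringHomComp i) (φ := χ.ringHomComp i)
    (by rw [ZMod.ringChar_zmod_n, ringChar.eq_zero]; exact (Fact.out : p.Prime).ne_zero.symm)
    ((MulChar.ringHomComp_ne_one_iff hi).mpr hne)
    ((MulChar.ringHomComp_ne_one_iff hi).mpr hne)
    (by rw [← MulChar.ringHomComp_mul]; exact (MulChar.ringHomComp_ne_one_iff hi).mpr hne2)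
  rw [MulChar.ringHomComp_inv, jacobiSum_ringHomComp, jacobiSum_ringHomComp, eis_star_char h3,
    jacobiSum_ringHomComp, ← map_mul, starRingEnd_apply,
    ← QuadraticAlgebra.algebraMap_norm_eq_mul_star, ZMod.card] at key
  have key2 : algebraMap ℤ EisRing (jacobiSum χ χ).norm = (p : EisRing) := hi (by simpa using key)
  have := congrArg QuadraticAlgebra.re key2
  simpa using this

lemma eis_jacobi_form {p : ℕ} [Fact p.Prime] (hp3 : p % 3 = 1) {χ : MulChar (ZMod p) EisRing}
    (h : orderOf χ = 3) : ∃ c d : ℤ, jacobiSum χ χ = ⟨-1 + 3 * c, 3 * d⟩ := by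
  have h3 : χ ^ 3 = 1 := h ▸ pow_orderOf_eq_one χ
  obtain ⟨z, -, hz⟩ := exists_jacobiSum_eq_neg_one_add (n := 3) (by norm_num) h3 h3
    (by rw [ZMod.card]; have := (Fact.out : p.Prime).two_le; omega) eisW_prim
  have h2 : (eisW - 1) ^ 2 = -3 * eisW := by linear_combination eisW_sq
  have h4 : ∃ w : EisRing, jacobiSum χ χ = -1 + 3 * w := ⟨-z * eisW, by rw [hz, h2]; ring⟩
  obtain ⟨w, hw⟩ := h4
  refine ⟨w.re, w.im, ?_⟩
  rw [hw]
  have e3 : (3 : EisRing) * w = w + w + w := by ring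
  rw [e3]
  ext
  · simp; ring
  · simp; ring

lemma uniq_rep {p : ℤ} (hp : Prime p) {L d X D : ℤ} (h1 : L ^ 2 + 27 * d ^ 2 = 4 * p)
    (h2 : X ^ 2 + 27 * D ^ 2 = 4 * p) (hL : L % 3 = 1) (hX : X % 3 = 1) :
    L = X ∧ (d = D ∨ d = -D) := by
  have hpos : 0 < p := by
    have := hp.ne_zero
    rcases lt_or_gt_of_ne this with h | h
    · nlinarith [sq_nonneg L, sq_nonneg d]
    · exact h
  have main : ∀ E : ℤ, X ^ 2 + 27 * E ^ 2 = 4 * p → p ∣ L * E - X * d → L = X ∧ d = E := by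
    intro E hE hdvd
    obtain ⟨k, hk⟩ := hdvd
    have e1 : (L * X + 27 * d * E) ^ 2 + 27 * (L * E - X * d) ^ 2 = 16 * p ^ 2 := by
      linear_combination (X ^ 2 + 27 * E ^ 2) * h1 + 4 * p * hE
    have hk0 : k = 0 := by
      rw [hk] at e1
      have : p ^ 2 * (27 * k ^ 2) ≤ p ^ 2 * 16 := by nlinarith [sq_nonneg (L * X + 27 * d * E)]
      have h27 : 27 * k ^ 2 ≤ 16 := le_of_mul_le_mul_left this (by positivity)
      have : k ^ 2 < 1 := by omega
      have : k ^ 2 = 0 := by nlinarith [sq_nonneg k]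
      simpa using this
    rw [hk0, mul_zero] at hk
    have e2 : L * (L * X + 27 * d * E) = 4 * p * X := by
      linear_combination X * h1 + 27 * d * hk
    have e3 : (L * X + 27 * d * E) ^ 2 = (4 * p) ^ 2 := by rw [hk] at e1; linear_combination e1
    have p4 : (4 * p) ≠ 0 := by positivity
    rcases sq_eq_sq_iff_eq_or_eq_neg.mp e3 with e | e
    · have hLX : L = X := by
        apply mul_left_cancel₀ p4; rw [e] at e2; linear_combination e2
      refine ⟨hLX, ?_⟩
      have hX0 : X ≠ 0 := by rintro rfl; simp at hX
      apply mul_left_cancel₀ hX0; rw [hLX] at hk; linear_combination -hk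
    · exfalso
      have hLX : L = -X := by
        apply mul_left_cancel₀ p4; rw [e] at e2; linear_combination -e2
      omega
  have hd : p ∣ (L * D - X * d) * (L * (-D) - X * d) := by
    refine ⟨4 * d ^ 2 - 4 * D ^ 2, ?_⟩
    linear_combination -D ^ 2 * h1 + d ^ 2 * h2
  rcases hp.dvd_or_dvd hd with h | h
  · exact ⟨(main D h2 h).1, Or.inl (main D h2 h).2⟩
  · have := main (-D) (by rw [neg_sq]; exact h2) h
    exact ⟨this.1, Or.inr this.2⟩

lemma char_eq_one_iff {p : ℕ} [Fact p.Prime] {F : Type*} [Field F] {χ : MulChar (ZMod p) F}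
    (h : orderOf χ = 3) {a : ZMod p} (ha : a ≠ 0) : χ a = 1 ↔ ∃ b, b ^ 3 = a := by
  have h3 : χ ^ 3 = 1 := h ▸ pow_orderOf_eq_one χ
  constructor
  · intro h1
    obtain ⟨g, hg⟩ := IsCyclic.exists_generator (α := (ZMod p)ˣ)
    obtain ⟨k, hk⟩ := Subgroup.mem_zpowers_iff.mp (hg (Units.mk0 a ha))
    let f := MulChar.toUnitHom χ
    have hf3 : f g ^ 3 = 1 := by
      ext; rw [Units.val_pow_eq_pow_val, MulChar.coe_toUnitHom, ← MulChar.pow_apply_coe, h3]; simp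
    have hfne : f g ≠ 1 := by
      intro hh
      have : χ = 1 := by
        rw [MulChar.eq_iff hg, ← MulChar.coe_toUnitHom]
        change ((f g : Fˣ) : F) = _
        rw [hh]; simp
      rw [this] at h; simp at h
    have hord : orderOf (f g) = 3 := orderOf_eq_prime hf3 hfne
    have hfk : (f g) ^ k = 1 := by
      rw [← map_zpow, hk]; ext; rw [MulChar.coe_toUnitHom]; simpa using h1
    have hdvd := orderOf_dvd_iff_zpow_eq_one.mpr hfk
    rw [hord] at hdvd
    obtain ⟨m, rfl⟩ := hdvd
    refine ⟨((g ^ m : (ZMod p)ˣ) : ZMod p), ?_⟩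
    rw [← Units.val_pow_eq_pow_val, ← zpow_natCast, ← zpow_mul, mul_comm]
    push_cast at hk ⊢
    have := congrArg Units.val hk
    simpa using this
  · rintro ⟨b, rfl⟩
    have hb : b ≠ 0 := by rintro rfl; simp at ha
    rw [map_pow, ← MulChar.pow_apply' _ (by norm_num), h3, MulChar.one_apply hb.isUnit]

lemma gauss_step {p q : ℕ} [Fact p.Prime] [Fact q.Prime] (hq1 : q % 3 = 1) (hqp : q ≠ p)
    {χ : MulChar (ZMod p) (ZMod q)} (h : orderOf χ = 3) :
    ((p : ZMod q) * jacobiSum χ χ) ^ ((q - 1) / 3) = χ⁻¹ (q : ZMod p) := by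
  have hp : p.Prime := Fact.out
  have hq : q.Prime := Fact.out
  have hqp0 : (q : ZMod p) ≠ 0 := by
    rw [Ne, ZMod.natCast_eq_zero_iff, Nat.prime_dvd_prime_iff_eq hp hq]; exact hqp.symm
  have hpq0 : (p : ZMod q) ≠ 0 := by
    rw [Ne, ZMod.natCast_eq_zero_iff, Nat.prime_dvd_prime_iff_eq hq hp]; exact hqp
  let P := AddChar.FiniteField.primitiveChar (ZMod p) (ZMod q)
    (by rw [ZMod.ringChar_zmod_n, ZMod.ringChar_zmod_n]; exact hqp)
  let FF := CyclotomicField P.n (ZMod q)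
  let i : ZMod q →+* FF := algebraMap (ZMod q) FF
  have hi : Function.Injective i := i.injective
  let χ' := χ.ringHomComp i
  have hne : χ ≠ 1 := by rintro rfl; simp at h
  have hne' : χ' ≠ 1 := (MulChar.ringHomComp_ne_one_iff hi).mpr hne
  have h3 : χ ^ 3 = 1 := h ▸ pow_orderOf_eq_one χ
  have h3' : χ' ^ 3 = 1 := by
    change (χ.ringHomComp i) ^ 3 = 1
    rw [MulChar.ringHomComp_pow, h3, MulChar.ringHomComp_one]
  have h' : orderOf χ' = 3 := orderOf_eq_prime h3' hne'
  have hchar : CharP FF q := charP_of_injective_algebraMap hi q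
  have hm1 : χ' (-1) = 1 := by
    have e := congrArg (fun c : MulChar (ZMod p) FF => c (-1)) h3'
    rw [MulChar.pow_apply' _ (by norm_num), ← map_pow, MulChar.one_apply isUnit_one.neg] at e
    convert e using 2; ring
  have hcube := gaussSum_pow_eq_prod_jacobiSum (χ := χ') (ψ := P.char) (by omega) P.prim
  rw [h', hm1, ZMod.card] at hcube
  have hIco : Finset.Ico 1 (3 - 1) = {1} := rfl
  rw [hIco, Finset.prod_singleton, pow_one, one_mul] at hcube
  have hg0 : gaussSum χ' P.char ≠ 0 := by
    apply gaussSum_ne_zero_of_nontrivial _ hne' P.prim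
    rw [ZMod.card]
    have := (map_ne_zero_iff i hi).mpr hpq0
    simpa using this
  have hfrob := gaussSum_frob q χ' P.char
  have hq' : χ' ^ q = χ' := by
    rw [← pow_mod_orderOf, h', hq1, pow_one]
  rw [hq', AddChar.pow_mulShift] at hfrob
  have hshift := gaussSum_mulShift_eq χ' P.char (Units.mk0 (q : ZMod p) hqp0)
  rw [Units.val_mk0] at hshift
  rw [hshift] at hfrob
  have hpow : gaussSum χ' P.char ^ (q - 1) = χ'⁻¹ (q : ZMod p) := by
    apply mul_right_cancel₀ hg0
    rw [← hfrob, ← pow_succ, Nat.sub_add_cancel hq.one_le]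
  have hexp : q - 1 = 3 * ((q - 1) / 3) := by omega
  rw [hexp, pow_mul, hcube] at hpow
  apply hi
  change ((p : FF) * jacobiSum (χ.ringHomComp i) (χ.ringHomComp i)) ^ _ =
    (χ.ringHomComp i)⁻¹ (q : ZMod p) at hpow
  rw [jacobiSum_ringHomComp, MulChar.ringHomComp_inv, MulChar.ringHomComp_apply] at hpow
  rw [← hpow]; simp

/-- Cubic residuacity criterion for a prime `q ≡ 1 (mod 3)`: with `p = x² + 243y²` as in the
unique representation, `q` is a cubic residue mod `p` iff `(p(x - 9ys))^{(q-1)/3} = 1` in `F_q`,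
where `s² = -3` in `F_q`. -/
theorem cubic_residue_criterion_q_one_mod_three (p : ℕ) (hp : p.Prime) (hp3 : p % 3 = 1)
    (h2 : ∃ a : ℤ, a ^ 3 ≡ 2 [ZMOD (p : ℤ)])
    (h3 : ∃ b : ℤ, b ^ 3 ≡ 3 [ZMOD (p : ℤ)])
    (x y : ℤ) (hxy : (p : ℤ) = x ^ 2 + 243 * y ^ 2)
    (hx6 : x ≡ 3 * y - 1 [ZMOD 6]) (hy : 0 < y)
    (q : ℕ) (hq : q.Prime) (hq3 : 3 < q) (hq1 : q % 3 = 1) (hqp : q ≠ p)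
    (s : ZMod q) (hs : s ^ 2 = -3) :
    (∃ a : ℤ, a ^ 3 ≡ (q : ℤ) [ZMOD (p : ℤ)]) ↔
      ((p : ZMod q) * ((x : ZMod q) - 9 * (y : ZMod q) * s)) ^ ((q - 1) / 3) = 1 := by
  have : Fact p.Prime := ⟨hp⟩
  have : Fact q.Prime := ⟨hq⟩
  obtain ⟨χ, hχ⟩ := MulChar.exists_mulChar_orderOf (ZMod p) (n := 3)
    (by rw [ZMod.card]; have := hp.two_le; omega) eisW_prim
  obtain ⟨c, d, hJ⟩ := eis_jacobi_form hp3 hχ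
  have hN := eis_jacobi_norm hχ
  rw [hJ, eis_norm] at hN
  simp only at hN
  have hx3 : (2 * x) % 3 = 1 := by
    have := hx6.dvd
    omega
  obtain ⟨hL, hd⟩ := uniq_rep (p := p) (Nat.prime_iff_prime_int.mp hp)
    (L := 2 * (-1 + 3 * c) - 3 * d) (d := d) (X := 2 * x) (D := 6 * y)
    (by linear_combination 4 * hN) (by rw [hxy]; ring) (by omega) hx3
  have h2ne : (2 : ZMod q) ≠ 0 := by
    intro h
    have : ((2 : ℕ) : ZMod q) = 0 := by exact_mod_cast h
    rw [ZMod.natCast_eq_zero_iff] at this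
    have := Nat.le_of_dvd (by norm_num) this
    omega
  have h3ne : (3 : ZMod q) ≠ 0 := by
    intro h
    have : ((3 : ℕ) : ZMod q) = 0 := by exact_mod_cast h
    rw [ZMod.natCast_eq_zero_iff] at this
    have := Nat.le_of_dvd (by norm_num) this
    omega
  -- choose the image of the cube root of unity
  have hw : ∃ w : ZMod q, w * w = (-1 : ℤ) • 1 + (-1 : ℤ) • w ∧
      ((-1 + 3 * c : ℤ) : ZMod q) + ((3 * d : ℤ) : ZMod q) * w
        = (x : ZMod q) - 9 * (y : ZMod q) * s := by
    have hLq : (2 : ZMod q) * (-1 + 3 * c) - 3 * d = 2 * x := by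
      have := congrArg (Int.cast : ℤ → ZMod q) hL
      push_cast at this
      exact this
    rcases hd with hd | hd
    · refine ⟨(-1 - s) / 2, ?_, ?_⟩
      · simp only [neg_smul, one_smul]
        field_simp
        linear_combination hs
      · subst hd
        push_cast at hLq ⊢
        field_simp
        linear_combination hLq
    · refine ⟨(-1 + s) / 2, ?_, ?_⟩
      · simp only [neg_smul, one_smul]
        field_simp
        linear_combination hs
      · subst hd
        push_cast at hLq ⊢
        field_simp
        linear_combination hLq
  obtain ⟨w, hw1, hw2⟩ := hw
  let φ : EisRing →ₐ[ℤ] ZMod q := QuadraticAlgebra.lift ⟨w, hw1⟩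
  have hφ : φ (jacobiSum χ χ) = (x : ZMod q) - 9 * (y : ZMod q) * s := by
    rw [hJ, ← hw2]; simp [φ, QuadraticAlgebra.lift]
  have hφw : φ eisW = w := by simp [φ, QuadraticAlgebra.lift, eisW]
  let χ' := χ.ringHomComp φ.toRingHom
  have h3 : χ ^ 3 = 1 := hχ ▸ pow_orderOf_eq_one χ
  have h3' : χ' ^ 3 = 1 := by
    change (χ.ringHomComp φ.toRingHom) ^ 3 = 1
    rw [MulChar.ringHomComp_pow, h3, MulChar.ringHomComp_one]
  have hw1' : w ^ 2 + w + 1 = 0 := by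
    simp only [neg_smul, one_smul] at hw1
    linear_combination hw1
  have hwne : w ≠ 1 := by
    rintro rfl
    exact h3ne (by linear_combination hw1')
  have hwprim : IsPrimitiveRoot w 3 := by
    have : orderOf w = 3 := orderOf_eq_prime (by linear_combination (w - 1) * hw1') hwne
    exact this ▸ IsPrimitiveRoot.orderOf w
  have hne' : χ' ≠ 1 := by
    intro hh
    have : χ = 1 := by
      refine MulChar.ext fun a => ?_
      obtain ⟨k, hk3, hk⟩ := χ.exists_apply_eq_pow h3 eisW_prim a.ne_zero
      have e : χ' a = 1 := by rw [hh]; simp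
      change φ (χ a) = 1 at e
      rw [hk, map_pow, hφw] at e
      have := hwprim.dvd_of_pow_eq_one k e
      have hk0 : k = 0 := by omega
      rw [hk, hk0]; simp
    rw [this] at hχ; simp at hχ
  have hord : orderOf χ' = 3 := orderOf_eq_prime h3' hne'
  have hJ' : jacobiSum χ' χ' = (x : ZMod q) - 9 * (y : ZMod q) * s := by
    rw [← hφ]; exact jacobiSum_ringHomComp χ χ φ.toRingHom
  have hqp0 : (q : ZMod p) ≠ 0 := by
    rw [Ne, ZMod.natCast_eq_zero_iff, Nat.prime_dvd_prime_iff_eq hp hq]; exact hqp.symm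
  have key := gauss_step hq1 hqp hord
  have hordinv : orderOf χ'⁻¹ = 3 := by rw [orderOf_inv, hord]
  rw [← hJ', key, char_eq_one_iff hordinv hqp0]
  constructor
  · rintro ⟨a, ha⟩
    refine ⟨(a : ZMod p), ?_⟩
    have := (ZMod.intCast_eq_intCast_iff _ _ _).mpr ha
    exact_mod_cast this
  · rintro ⟨b, hb⟩
    obtain ⟨a, rfl⟩ := ZMod.intCast_surjective b
    refine ⟨a, (ZMod.intCast_eq_intCast_iff _ _ _).mp ?_⟩
    exact_mod_cast hb
end

section
/- Let p be a prime with p ≡ 1 (mod 3) such that 2 and 3 are cubic residues modulo p, and write p = x² + 243·y² with integers x, y satisfying x ≡ 3y − 1 (mod 6) and y > 0. Let q be a prime with q > 3 and q ≡ 2 (mod 3), let F be a finite field with q² elements, and let t ∈ F satisfy t² = −3. Then q is a cubic residue modulo p (i.e., there exists an integer a with a³ ≡ q (mod p)) if and only if ( x + 9·y·t )^{(q²−1)/3} = 1 in F, where x and y are interpreted in F via the ring homomorphism from ℤ to F. -/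
abbrev EisInt := QuadraticAlgebra ℤ (-1) (-1)

namespace EisInt

lemma norm_eq (z : EisInt) : QuadraticAlgebra.norm z = z.re ^ 2 - z.re * z.im + z.im ^ 2 := by
  rw [QuadraticAlgebra.norm_def]; ring

lemma norm_eq_zero {z : EisInt} (h : QuadraticAlgebra.norm z = 0) : z = 0 := by
  rw [norm_eq] at h
  have h1 : z.im = 0 := by
    have : z.im ^ 2 = 0 := by nlinarith [sq_nonneg (2 * z.re - z.im), sq_nonneg z.im]
    exact pow_eq_zero_iff (two_ne_zero) |>.1 this
  have h2 : z.re = 0 := by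
    rw [h1] at h
    have : z.re ^ 2 = 0 := by linarith
    exact pow_eq_zero_iff (two_ne_zero) |>.1 this
  exact QuadraticAlgebra.ext h2 h1

instance : IsDomain EisInt :=
  have : NoZeroDivisors EisInt := ⟨fun {a b} h => by
    have : QuadraticAlgebra.norm a * QuadraticAlgebra.norm b = 0 := by
      rw [← map_mul, h, QuadraticAlgebra.norm_zero]
    exact (mul_eq_zero.1 this).imp norm_eq_zero norm_eq_zero⟩
  NoZeroDivisors.to_isDomain _

instance : CharZero EisInt := ⟨fun a b h => by
  have := congrArg QuadraticAlgebra.re h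
  simpa using this⟩

/-- the cube root of unity -/
def w : EisInt := ⟨0, 1⟩

lemma isPrimitiveRoot_of {R : Type*} [CommRing R] [IsDomain R] {z : R} (h : z ^ 2 + z + 1 = 0)
    (h3 : (3 : R) ≠ 0) : IsPrimitiveRoot z 3 := by
  have hz : z ^ 3 = 1 := by linear_combination (z - 1) * h
  have h1 : z ≠ 1 := by
    rintro rfl
    exact h3 (by linear_combination h)
  have := IsPrimitiveRoot.orderOf z
  rwa [orderOf_eq_prime hz h1] at this

lemma w_rel : w ^ 2 + w + 1 = 0 := by
  rw [pow_two]; ext <;> simp [w, show (1 : EisInt).re = 1 from rfl, show (1 : EisInt).im = 0 from rfl]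

lemma w_prim : IsPrimitiveRoot w 3 := isPrimitiveRoot_of w_rel (by norm_num)

lemma sum_w (z : EisInt) : z = (z.re : EisInt) + z.im * w := by
  ext <;> simp [w]

lemma star_w : star w = w ^ 2 := by
  rw [pow_two]; ext <;> simp [w]

end EisInt

lemma rep_unique {p : ℕ} (hp : p.Prime) (hp3 : p % 3 = 1) {x y a m : ℤ}
    (hxy : (p : ℤ) = x ^ 2 + 243 * y ^ 2) (hx : x % 3 = 2)
    (hab : a ^ 2 - a * (3 * m) + (3 * m) ^ 2 = p) (ha : a % 3 = 2) :
    (a = x + 9 * y ∧ 3 * m = 18 * y) ∨ (a = x - 9 * y ∧ 3 * m = -(18 * y)) := by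
  have hp0 : (0 : ℤ) < p := by exact_mod_cast hp.pos
  obtain ⟨L, hL⟩ : ∃ L, L = 2 * a - 3 * m := ⟨_, rfl⟩
  have h4 : L ^ 2 + 27 * m ^ 2 = 4 * p := by rw [hL]; linear_combination 4 * hab
  have hpr : Prime (p : ℤ) := Nat.prime_iff_prime_int.1 hp
  have key : (L * (9 * y) - x * (3 * m)) * (L * (9 * y) + x * (3 * m))
      = p * (4 * (9 * y) ^ 2 - (3 * m) ^ 2) := by
    linear_combination 81 * y ^ 2 * h4 + 9 * m ^ 2 * hxy
  have aux : ∀ e : ℤ, e ^ 2 = 1 → (p : ℤ) ∣ L * (9 * y) - e * x * (3 * m) →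
      L * (9 * y) - e * x * (3 * m) = 0 := by
    rintro e he ⟨k, hk⟩
    have h1 : (L * x + e * 3 * (3 * m) * (9 * y)) ^ 2
        + 3 * (L * (9 * y) - e * x * (3 * m)) ^ 2 = 4 * p * p := by
      linear_combination p * h4 - (L ^ 2 + 27 * m ^ 2) * hxy + (27 * m ^ 2 * x ^ 2 + 81 * 81 * m ^ 2 * y ^ 2) * he
    rw [hk] at h1
    have hk3 : (3 : ℤ) ∣ k := by
      have : (3 : ℤ) ∣ p * k := ⟨L * (3 * y) - e * x * m, by rw [← hk]; ring⟩
      rcases Int.prime_three.dvd_or_dvd this with h | h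
      · omega
      · exact h
    obtain ⟨j, rfl⟩ := hk3
    have hj : j ^ 2 < 1 := by
      by_contra hj
      nlinarith [sq_nonneg (L * x + e * 3 * (3 * m) * (9 * y)), mul_pos hp0 hp0,
        mul_le_mul_of_nonneg_left (not_lt.1 hj) (mul_pos hp0 hp0).le]
    have : j = 0 := by nlinarith
    rw [hk, this]; simp
  have hz : 4 * (9 * y) ^ 2 - (3 * m) ^ 2 = 0 := by
    have : (p : ℤ) * (4 * (9 * y) ^ 2 - (3 * m) ^ 2) = 0 := by
      rw [← key]
      rcases hpr.dvd_or_dvd (Dvd.intro _ key.symm) with h | h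
      · have := aux 1 (by norm_num) (by simpa using h)
        rw [one_mul] at this
        rw [this, zero_mul]
      · have := aux (-1) (by norm_num) (by rwa [neg_one_mul, neg_mul, sub_neg_eq_add])
        have h0 : L * (9 * y) + x * (3 * m) = 0 := by linarith
        rw [h0, mul_zero]
    exact (mul_eq_zero.1 this).resolve_left hp0.ne'
  have hLx : (L - 2 * x) * (L + 2 * x) = 0 := by linear_combination h4 + 4 * hxy + 3 * hz
  have hm : (18 * y - 3 * m) * (18 * y + 3 * m) = 0 := by linear_combination hz
  rcases mul_eq_zero.1 hLx with h | h <;> rcases mul_eq_zero.1 hm with h' | h' <;> omega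

lemma mulChar_eq_one_iff {K R : Type*} [Field K] [Fintype K] [CommRing R]
    {χ : MulChar K R} (hχ : orderOf χ = 3) (u : Kˣ) :
    χ u = 1 ↔ ∃ v : K, v ^ 3 = u := by
  constructor
  · intro h
    obtain ⟨g, hg⟩ := IsCyclic.exists_generator (α := Kˣ)
    obtain ⟨n, rfl⟩ : ∃ n : ℕ, g ^ n = u := by
      have := hg u
      rwa [← mem_powers_iff_mem_zpowers] at this
    have h1 : χ ^ n = 1 := by
      rw [MulChar.eq_iff hg, MulChar.pow_apply_coe, MulChar.one_apply_coe, ← map_pow]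
      simpa using h
    rw [← orderOf_dvd_iff_pow_eq_one, hχ] at h1
    obtain ⟨k, rfl⟩ := h1
    exact ⟨(g : K) ^ k, by push_cast; ring⟩
  · rintro ⟨v, hv⟩
    have hv0 : v ≠ 0 := by
      rintro rfl
      exact u.ne_zero (by rw [← hv]; simp)
    rw [← hv, map_pow, ← MulChar.pow_apply' χ three_ne_zero, ← hχ, pow_orderOf_eq_one,
      MulChar.one_apply hv0.isUnit]

lemma jacobi_norm {p : ℕ} [Fact p.Prime] {χ : MulChar (ZMod p) EisInt} (hχ : orderOf χ = 3) :
    QuadraticAlgebra.norm (jacobiSum χ χ) = (p : ℤ) := by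
  let f := algebraMap EisInt (FractionRing EisInt)
  have hf : Function.Injective f := IsFractionRing.injective _ _
  have h3 : χ ^ 3 = 1 := hχ ▸ pow_orderOf_eq_one χ
  have hst : χ.ringHomComp (starRingEnd EisInt) = χ⁻¹ := by
    rw [eq_inv_iff_mul_eq_one]
    refine MulChar.ext fun u => ?_
    obtain ⟨k, -, hk⟩ := MulChar.exists_apply_eq_pow h3 EisInt.w_prim u.ne_zero
    rw [MulChar.mul_apply, MulChar.one_apply_coe, MulChar.ringHomComp_apply, hk, map_pow,
      starRingEnd_apply, EisInt.star_w, ← mul_pow, ← pow_succ, EisInt.w_prim.pow_eq_one, one_pow]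
  have hne : ∀ n, ¬ 3 ∣ n → (χ.ringHomComp f) ^ n ≠ 1 := by
    intro n hn h
    rw [MulChar.ringHomComp_pow, MulChar.ringHomComp_eq_one_iff hf, ← orderOf_dvd_iff_pow_eq_one, hχ] at h
    exact hn h
  have h1 := hne 1 (by norm_num)
  rw [pow_one] at h1
  have h2 := hne 2 (by norm_num)
  rw [pow_two] at h2
  have hc : ringChar (FractionRing EisInt) ≠ ringChar (ZMod p) := by
    have : CharZero (FractionRing EisInt) := charZero_of_injective_algebraMap hf
    rw [ringChar.eq_zero, ZMod.ringChar_zmod_n]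
    exact (Fact.out : p.Prime).ne_zero.symm
  have := jacobiSum_mul_jacobiSum_inv hc h1 h1 h2
  rw [MulChar.ringHomComp_inv, jacobiSum_ringHomComp, jacobiSum_ringHomComp, ← hst, jacobiSum_ringHomComp, ← map_mul,
    starRingEnd_apply, ← QuadraticAlgebra.algebraMap_norm_eq_mul_star, ZMod.card,
    ← map_natCast f] at this
  have := hf this
  have := congrArg QuadraticAlgebra.re this
  simpa using this

lemma jacobi_shape {p : ℕ} [Fact p.Prime] (hp3 : p % 3 = 1) {χ : MulChar (ZMod p) EisInt}
    (hχ : orderOf χ = 3) :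
    ∃ m : ℤ, (jacobiSum χ χ).im = 3 * m ∧ (jacobiSum χ χ).re % 3 = 2 := by
  have h3 : χ ^ 3 = 1 := hχ ▸ pow_orderOf_eq_one χ
  obtain ⟨z, -, hz⟩ := exists_jacobiSum_eq_neg_one_add (by norm_num) h3 h3
    (by rw [ZMod.card]; omega) EisInt.w_prim
  have : jacobiSum χ χ = -1 + 3 * (-(z * EisInt.w)) := by
    rw [hz]; linear_combination z * EisInt.w_rel
  rw [this]
  generalize -(z * EisInt.w) = u
  have h1 : (3 : EisInt).re = 3 := rfl
  have h2 : (3 : EisInt).im = 0 := rfl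
  have h1' : (1 : EisInt).re = 1 := rfl
  have h2' : (1 : EisInt).im = 0 := rfl
  refine ⟨u.im, ?_, ?_⟩
  · simp [h1, h2, h2']
  · simp [h1, h2, h1']

lemma gauss_step_s19 {p q : ℕ} [Fact p.Prime] [Fact q.Prime] (hpq : p ≠ q) (hq2 : q % 3 = 2)
    {F : Type*} [Field F] [Fintype F] [CharP F q] {χ : MulChar (ZMod p) F} (hχ : orderOf χ = 3) :
    χ q = 1 ↔ jacobiSum χ χ ^ ((q ^ 2 - 1) / 3) = 1 := by
  have hqp : q.Prime := Fact.out
  have hpp : p.Prime := Fact.out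
  have hc : ringChar F ≠ ringChar (ZMod p) := by
    rw [ringChar.eq F q, ZMod.ringChar_zmod_n]; exact hpq.symm
  let P := AddChar.FiniteField.primitiveChar (ZMod p) F hc
  let K := CyclotomicField P.n F
  let f := algebraMap F K
  have hf : Function.Injective f := f.injective
  have : CharP K q := charP_of_injective_algebraMap hf q
  let X := χ.ringHomComp f
  have hX : orderOf X = 3 := by
    refine orderOf_eq_prime ?_ ?_
    · rw [MulChar.ringHomComp_pow, ← hχ, pow_orderOf_eq_one]; simp
    · intro h
      rw [MulChar.ringHomComp_eq_one_iff hf] at h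
      rw [h] at hχ; simp at hχ
  have hX3 : X ^ 3 = 1 := hX ▸ pow_orderOf_eq_one X
  let ψ : AddChar (ZMod p) K := P.char
  have hψ : ψ.IsPrimitive := P.prim
  let G := gaussSum X ψ
  have hdvd : 3 ∣ q ^ 2 - 1 := by
    rw [← Nat.modEq_iff_dvd' (Nat.one_le_pow _ _ hqp.pos)]
    simp [Nat.ModEq, Nat.pow_mod, hq2]
  obtain ⟨n, hn⟩ := hdvd
  have hnq : (q - 1) ∣ n := by
    have h1 : (q - 1) * (q + 1) = 3 * n := by
      rw [← hn, mul_comm, ← Nat.sq_sub_sq]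
    obtain ⟨k, hk⟩ : 3 ∣ q + 1 := by omega
    exact ⟨k, by rw [hk] at h1; nlinarith⟩
  have hpF : ((p : ℕ) : K) ≠ 0 := by
    rw [Ne, CharP.cast_eq_zero_iff K q]
    exact fun h => hpq ((Nat.prime_dvd_prime_iff_eq hqp hpp).1 h).symm
  have hpn : ((p : ℕ) : K) ^ n = 1 := by
    obtain ⟨k, rfl⟩ := hnq
    have : ((p : ℕ) : ZMod q) ^ (q - 1) = 1 := ZMod.pow_card_sub_one_eq_one (by
      rw [Ne, ZMod.natCast_eq_zero_iff]
      exact fun h => hpq ((Nat.prime_dvd_prime_iff_eq hqp hpp).1 h).symm)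
    have := congrArg (ZMod.castHom (dvd_refl q) K) this
    rw [map_pow, map_natCast, map_one] at this
    rw [pow_mul, this, one_pow]
  have hneg : X (-1) = 1 := by
    have := (mulChar_eq_one_iff hX (-1)).2 ⟨-1, by push_cast; ring⟩
    simpa using this
  have hG3 : G ^ 3 = p * f (jacobiSum χ χ) := by
    have := gaussSum_pow_eq_prod_jacobiSum (χ := X) (ψ := ψ) (by rw [hX]; norm_num) hψ
    rw [hX, hneg] at this
    simpa [X, jacobiSum_ringHomComp] using this
  have hG0 : G ≠ 0 := gaussSum_ne_zero_of_nontrivial (by rwa [ZMod.card])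
    (by intro h; rw [h] at hX; simp at hX) hψ
  have hqu : IsUnit (q : ZMod p) := by
    rw [isUnit_iff_ne_zero, Ne, ZMod.natCast_eq_zero_iff]
    exact fun h => hpq ((Nat.prime_dvd_prime_iff_eq hpp hqp).1 h)
  have hGq : X q ^ 2 * G ^ (q ^ 2) = G := by
    have h1 : G ^ (q ^ 2) = gaussSum (X ^ (q ^ 2)) (ψ ^ (q ^ 2)) := by
      rw [pow_two, pow_mul, gaussSum_frob, gaussSum_frob, ← pow_mul, ← pow_mul]
    have h2 : X ^ (q ^ 2) = X := by
      have : q ^ 2 = 3 * n + 1 := by have := Nat.one_le_pow 2 q hqp.pos; omega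
      rw [this, pow_succ, pow_mul, hX3, one_pow, one_mul]
    rw [h1, h2, AddChar.pow_mulShift, ← map_pow]
    have := gaussSum_mulShift X ψ (hqu.unit ^ 2)
    simpa using this
  have hGn : X q ^ 2 * f (jacobiSum χ χ) ^ n = 1 := by
    have h1 : G ^ (q ^ 2) = f (jacobiSum χ χ) ^ n * G := by
      have : q ^ 2 = 3 * n + 1 := by have := Nat.one_le_pow 2 q hqp.pos; omega
      rw [this, pow_succ, pow_mul, hG3, mul_pow, hpn, one_mul]
    rw [h1, ← mul_assoc] at hGq
    exact mul_right_cancel₀ hG0 (by rw [hGq, one_mul])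
  have hXq : X q = f (χ q) := rfl
  have hXq3 : X q ^ 3 = 1 := by
    rw [← MulChar.pow_apply' X three_ne_zero, hX3, MulChar.one_apply hqu]
  rw [hn, Nat.mul_div_cancel_left _ (by norm_num)]
  rw [← hf.eq_iff (a := χ q), ← hf.eq_iff (a := _ ^ n), map_one, map_pow, ← hXq]
  constructor
  · intro h; simpa [h] using hGn
  · intro h
    rw [h, mul_one] at hGn
    rw [pow_succ, hGn, one_mul] at hXq3
    exact hXq3



/-- Cubic residuacity criterion for a prime `q ≡ 2 (mod 3)`: with `p = x² + 243y²` as in the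
unique representation, `q` is a cubic residue mod `p` iff `(x + 9yt)^{(q²-1)/3} = 1` in the
field `F` with `q²` elements, where `t² = -3` in `F`. -/
theorem cubic_residue_criterion_q_two_mod_three (p : ℕ) (hp : p.Prime) (hp3 : p % 3 = 1)
    (h2 : ∃ a : ℤ, a ^ 3 ≡ 2 [ZMOD (p : ℤ)])
    (h3 : ∃ b : ℤ, b ^ 3 ≡ 3 [ZMOD (p : ℤ)])
    (x y : ℤ) (hxy : (p : ℤ) = x ^ 2 + 243 * y ^ 2)
    (hx6 : x ≡ 3 * y - 1 [ZMOD 6]) (hy : 0 < y)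
    (q : ℕ) (hq : q.Prime) (hq3 : 3 < q) (hq2 : q % 3 = 2)
    (F : Type*) [Field F] [Fintype F] (hF : Fintype.card F = q ^ 2)
    (t : F) (ht : t ^ 2 = -3) :
    (∃ a : ℤ, a ^ 3 ≡ (q : ℤ) [ZMOD (p : ℤ)]) ↔
      ((x : F) + 9 * (y : F) * t) ^ ((q ^ 2 - 1) / 3) = 1 := by
  have : Fact p.Prime := ⟨hp⟩
  have : Fact q.Prime := ⟨hq⟩
  have hpq : p ≠ q := by rintro rfl; omega
  have : CharP F q := by
    obtain ⟨r, hr⟩ := CharP.exists F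
    obtain ⟨n, hrp, hn⟩ := FiniteField.card F r
    rw [hF] at hn
    have : r ∣ q ^ 2 := hn ▸ dvd_pow_self r n.ne_zero
    have := (Nat.prime_dvd_prime_iff_eq hrp hq).1 (hrp.dvd_of_dvd_pow this)
    exact this ▸ hr
  have hF0 : ∀ k : ℕ, 0 < k → k < q → ((k : ℕ) : F) ≠ 0 := fun k h0 hk h => by
    rw [CharP.cast_eq_zero_iff F q] at h
    exact absurd (Nat.le_of_dvd h0 h) (by omega)
  have hF2 : (2 : F) ≠ 0 := by exact_mod_cast hF0 2 (by norm_num) (by omega)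
  have hF3 : (3 : F) ≠ 0 := by exact_mod_cast hF0 3 (by norm_num) (by omega)
  obtain ⟨χ, hχ⟩ := MulChar.exists_mulChar_orderOf (ZMod p) (n := 3)
    (by rw [ZMod.card]; omega) EisInt.w_prim
  obtain ⟨m, him, hre⟩ := jacobi_shape hp3 hχ
  have hnorm := jacobi_norm hχ
  rw [EisInt.norm_eq, him] at hnorm
  have hx3 : x % 3 = 2 := by
    have := hx6; unfold Int.ModEq at this; omega
  obtain ⟨s, hs, hsJ⟩ : ∃ s : F, s ^ 2 = -3 ∧
      ((jacobiSum χ χ).re : F) + ((jacobiSum χ χ).im : F) * ((-1 + s) / 2) = x + 9 * y * t := by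
    rcases rep_unique hp hp3 hxy hx3 hnorm hre with ⟨h1, h2⟩ | ⟨h1, h2⟩
    · refine ⟨t, ht, ?_⟩
      rw [him, h2, h1]; push_cast; field_simp; ring
    · refine ⟨-t, by rw [neg_sq, ht], ?_⟩
      rw [him, h2, h1]; push_cast; field_simp; ring
  have hs2 : ((-1 + s) / 2) ^ 2 + (-1 + s) / 2 + 1 = 0 := by
    field_simp; linear_combination hs
  let φ : EisInt →+* F := (QuadraticAlgebra.lift (R := ℤ) (a := -1) (b := -1) (A := F)
    ⟨(-1 + s) / 2, by simp only [neg_smul, one_smul]; linear_combination hs2⟩).toRingHom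
  have hφw : φ EisInt.w = (-1 + s) / 2 := by
    simp [φ, EisInt.w, QuadraticAlgebra.lift]
  have hφJ : φ (jacobiSum χ χ) = x + 9 * y * t := by
    rw [← hsJ, EisInt.sum_w (jacobiSum χ χ), map_add, map_mul, map_intCast, map_intCast, hφw,
      ← EisInt.sum_w (jacobiSum χ χ)]
  have hprim : IsPrimitiveRoot (φ EisInt.w) 3 := by
    rw [hφw]; exact EisInt.isPrimitiveRoot_of hs2 hF3
  have h3 : χ ^ 3 = 1 := hχ ▸ pow_orderOf_eq_one χ
  have hX : orderOf (χ.ringHomComp φ) = 3 := by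
    refine orderOf_eq_prime ?_ ?_
    · rw [MulChar.ringHomComp_pow, h3]; simp
    · intro h
      have : χ = 1 := by
        refine MulChar.ext fun u => ?_
        obtain ⟨k, hk3, hk⟩ := MulChar.exists_apply_eq_pow h3 EisInt.w_prim u.ne_zero
        have h' : χ.ringHomComp φ u = 1 := by rw [h, MulChar.one_apply_coe]
        rw [MulChar.ringHomComp_apply, hk, map_pow] at h'
        have := Nat.eq_zero_of_dvd_of_lt (hprim.dvd_of_pow_eq_one _ h') hk3
        rw [hk, this, pow_zero, MulChar.one_apply_coe]
      rw [this] at hχ; simp at hχ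
  have main := gauss_step_s19 hpq hq2 hX
  rw [jacobiSum_ringHomComp, hφJ] at main
  rw [← main]
  have hqu : IsUnit (q : ZMod p) := by
    rw [isUnit_iff_ne_zero, Ne, ZMod.natCast_eq_zero_iff]
    exact fun h => hpq ((Nat.prime_dvd_prime_iff_eq hp hq).1 h)
  have hc := mulChar_eq_one_iff hX hqu.unit
  rw [IsUnit.unit_spec] at hc
  rw [hc]
  constructor
  · rintro ⟨a, ha⟩
    refine ⟨(a : ZMod p), ?_⟩
    have := (ZMod.intCast_eq_intCast_iff _ _ p).2 ha
    exact_mod_cast this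
  · rintro ⟨v, hv⟩
    refine ⟨(v.val : ℤ), ?_⟩
    rw [← ZMod.intCast_eq_intCast_iff]
    push_cast
    rw [ZMod.natCast_zmod_val, hv]
end
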